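/- Let G be a simple undirected graph with n vertices and adjacency matrix A. Then n minus the maximum, over all real eigenvalues λ of A, of the algebraic multiplicity of λ, is at most gc(G). -/

import Mathlib

open Matrix

def GCFeasible {V : Type*} [Fintype V] (A : Matrix V V ℝ) (m : ℕ) : Prop :=
  ∃ (k : ℕ) (P : Matrix (Fin k) V ℝ) (w : Fin k → ℝ),
    (∀ p i, P p i = 1 ∨ P p i = -1) ∧
    (∀ i, A i i = 0) ∧
    (∀ i j, i ≠ j → A i j = (Pᵀ * Matrix.diagonal w * P) i j) ∧
    m = (Finset.univ.filter fun p => w p ≠ 0).card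

noncomputable def gc {V : Type*} [Fintype V] (A : Matrix V V ℝ) : ℕ :=
  sInf { m | GCFeasible A m }

open scoped Classical in
noncomputable def gcGraph {V : Type*} [Fintype V] (G : SimpleGraph V) : ℕ :=
  gc (Matrix.of fun u v => if G.Adj u v then (1 : ℝ) else 0)

/-- Entrywise formula for a congruence transform of a diagonal matrix. -/
lemma transpose_mul_diagonal_mul_apply {ι V : Type*} [Fintype ι] [DecidableEq ι]
    (P : Matrix ι V ℝ) (w : ι → ℝ) (i j : V) :
    (Pᵀ * Matrix.diagonal w * P) i j = ∑ p, w p * (P p i * P p j) := by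
  rw [Matrix.mul_apply]
  refine Finset.sum_congr rfl fun p _ => ?_
  rw [Matrix.mul_diagonal, Matrix.transpose_apply]
  ring

/-- A coupling indexed by an arbitrary finite type yields feasibility. -/
lemma GCFeasible.of_fintype {ι V : Type*} [Fintype ι] [Fintype V]
    {A : Matrix V V ℝ} (P : Matrix ι V ℝ) (w : ι → ℝ)
    (hP : ∀ p i, P p i = 1 ∨ P p i = -1) (hA : ∀ i, A i i = 0)
    (h : ∀ i j, i ≠ j → A i j = ∑ p, w p * (P p i * P p j)) :
    ∃ m, GCFeasible A m := by
  let e := (Fintype.equivFin ι).symm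
  refine ⟨_, Fintype.card ι, P.submatrix e id, fun p => w (e p), fun p => hP (e p), hA, ?_, rfl⟩
  intro i j hij
  rw [transpose_mul_diagonal_mul_apply, h i j hij]
  exact (e.sum_comp fun p => w p * (P p i * P p j)).symm

/-- The sign vector that is `-1` exactly at `u` if `s` holds, and constantly `1` otherwise. -/
def flipSign {V : Type*} [DecidableEq V] (u : V) (s : Bool) (i : V) : ℝ :=
  if s = true ∧ i = u then -1 else 1

lemma flipSign_eq_or {V : Type*} [DecidableEq V] (u : V) (s : Bool) (i : V) :
    flipSign u s i = 1 ∨ flipSign u s i = -1 := by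
  unfold flipSign
  split_ifs <;> simp

lemma sum_sign_mul_flipSign {V : Type*} [DecidableEq V] (u i j : V) (hij : i ≠ j) :
    ∑ s : Bool, (bif s then (-1 : ℝ) else 1) * (flipSign u s i * flipSign u s j) =
      2 * ((if u = i then 1 else 0) + (if u = j then 1 else 0)) := by
  rw [Fintype.sum_bool]
  by_cases hi : u = i
  · subst hi
    simp [flipSign, hij, hij.symm]
    norm_num
  · by_cases hj : u = j
    · subst hj
      simp [flipSign, hij, hij.symm]
      norm_num
    · simp [flipSign, hi, hj, Ne.symm hi, Ne.symm hj]

/-- Every symmetric matrix with zero diagonal admits a graph coupling. -/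
lemma exists_gcFeasible {V : Type*} [Fintype V] (A : Matrix V V ℝ)
    (hsymm : A.IsSymm) (hA : ∀ i, A i i = 0) : ∃ m, GCFeasible A m := by
  classical
  refine GCFeasible.of_fintype (ι := (V × V) × (Bool × Bool))
    (Matrix.of fun p i => flipSign p.1.1 p.2.1 i * flipSign p.1.2 p.2.2 i)
    (fun p => A p.1.1 p.1.2 / 8 *
      ((bif p.2.1 then -1 else 1) * (bif p.2.2 then -1 else 1))) ?_ hA ?_
  · intro p i
    rcases flipSign_eq_or p.1.1 p.2.1 i with h | h <;>
      rcases flipSign_eq_or p.1.2 p.2.2 i with h' | h' <;> simp [h, h']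
  · intro i j hij
    have key : ∀ u v : V, ∑ q : Bool × Bool,
        A u v / 8 * ((bif q.1 then -1 else 1) * (bif q.2 then -1 else 1)) *
          ((flipSign u q.1 i * flipSign v q.2 i) * (flipSign u q.1 j * flipSign v q.2 j)) =
        A u v / 2 * (((if u = i then 1 else 0) + (if u = j then 1 else 0)) *
          ((if v = i then 1 else 0) + (if v = j then 1 else 0))) := by
      intro u v
      calc _ = A u v / 8 *
            ((∑ s : Bool, (bif s then (-1 : ℝ) else 1) * (flipSign u s i * flipSign u s j)) *
            ∑ t : Bool, (bif t then (-1 : ℝ) else 1) * (flipSign v t i * flipSign v t j)) := by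
              rw [Finset.sum_mul_sum, ← Fintype.sum_prod_type', Finset.mul_sum]
              exact Finset.sum_congr rfl fun q _ => by ring
        _ = _ := by
              rw [sum_sign_mul_flipSign u i j hij, sum_sign_mul_flipSign v i j hij]
              ring
    rw [Fintype.sum_prod_type]
    simp only [Matrix.of_apply, key]
    rw [Fintype.sum_prod_type]
    simp [mul_add, Finset.sum_add_distrib, hA, hsymm.apply i j]

/-- A coupling with `m` nonzero weights forces an eigenspace of dimension at least
`card V - m`. -/
lemma GCFeasible.exists_finrank_eigenspace {V : Type*} [Fintype V] [DecidableEq V]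
    {A : Matrix V V ℝ} {m : ℕ} (h : GCFeasible A m) :
    ∃ μ : ℝ, Fintype.card V ≤
      m + Module.finrank ℝ (Module.End.eigenspace (Matrix.toLin' A) μ) := by
  obtain ⟨k, P, w, hP, hA, hoff, rfl⟩ := h
  have hB : A - Matrix.scalar V (-∑ p, w p) = Pᵀ * Matrix.diagonal w * P := by
    ext i j
    by_cases hij : i = j
    · subst hij
      rw [transpose_mul_diagonal_mul_apply]
      have : ∀ p, P p i * P p i = 1 := fun p => by
        rcases hP p i with h | h <;> simp [h]
      simp [hA, this]
    · rw [← hoff i j hij]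
      simp [hij]
  refine ⟨-∑ p, w p, ?_⟩
  have hker : Module.End.eigenspace (Matrix.toLin' A) (-∑ p, w p) =
      LinearMap.ker (Matrix.toLin' (Pᵀ * Matrix.diagonal w * P)) := by
    rw [Module.End.eigenspace_def, ← hB, map_sub]
    congr 2
    ext i j
    by_cases hij : i = j
    · subst hij
      simp
    · simp [Ne.symm hij]
  have hrank : (Pᵀ * Matrix.diagonal w * P).rank ≤
      (Finset.univ.filter fun p => w p ≠ 0).card := by
    refine (Matrix.rank_mul_le_left _ _).trans ((Matrix.rank_mul_le_right _ _).trans ?_)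
    rw [Matrix.rank_diagonal, Fintype.card_subtype]
  have hnull := LinearMap.finrank_range_add_finrank_ker
    (Matrix.toLin' (Pᵀ * Matrix.diagonal w * P))
  rw [Module.finrank_fintype_fun_eq_card, Matrix.toLin'_apply', ← Matrix.rank] at hnull
  rw [hker, Matrix.toLin'_apply']
  omega

/-- Corollary: n minus the maximum multiplicity of an eigenvalue of the adjacency
matrix is at most gc(G). -/
theorem spectral_lower_bound {n : ℕ} (G : SimpleGraph (Fin n)) [DecidableRel G.Adj] :
    n - sSup {d : ℕ | ∃ μ : ℝ,
        Module.End.HasEigenvalue (Matrix.toLin' (G.adjMatrix ℝ)) μ ∧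
        d = Module.finrank ℝ
          (Module.End.eigenspace (Matrix.toLin' (G.adjMatrix ℝ)) μ)}
      ≤ gcGraph G := by
  have hadj : gcGraph G = gc (G.adjMatrix ℝ) := by
    unfold gcGraph
    congr 1
    ext u v
    simp [SimpleGraph.adjMatrix_apply]
  have hfeas : GCFeasible (G.adjMatrix ℝ) (gc (G.adjMatrix ℝ)) :=
    Nat.sInf_mem (exists_gcFeasible (G.adjMatrix ℝ) G.isSymm_adjMatrix (by simp))
  obtain ⟨μ, hμ⟩ := hfeas.exists_finrank_eigenspace
  rw [hadj]
  rw [Fintype.card_fin] at hμ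
  by_cases hbot : Module.End.eigenspace (Matrix.toLin' (G.adjMatrix ℝ)) μ = ⊥
  · rw [hbot, finrank_bot] at hμ
    omega
  · have hle := le_csSup (s := {d : ℕ | ∃ μ : ℝ,
        Module.End.HasEigenvalue (Matrix.toLin' (G.adjMatrix ℝ)) μ ∧
        d = Module.finrank ℝ (Module.End.eigenspace (Matrix.toLin' (G.adjMatrix ℝ)) μ)})
      ⟨n, by
        rintro d ⟨ν, -, rfl⟩
        simpa using Submodule.finrank_le
          (Module.End.eigenspace (Matrix.toLin' (G.adjMatrix ℝ)) ν)⟩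
      ⟨μ, hbot, rfl⟩
    omega
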